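/- Let ℓ > 0 and μ ∈ ℝ, set τ := 2πi/ℓ, assume θ₃(μ;τ) ≠ 0, and let n ≥ 3. Let w₁,…,w_{n+1} ∈ ℂ and set w₀ := wₙ. Assume that for every k ∈ {1,…,n}: w_k − w_{k−1} ∉ ℤ + τℤ, θ₃(w_k − w_{k−1} + μ; τ) ≠ 0, w_{n+1} − w_{k−1} ∉ ℤ + τℤ, and w_k − w_{n+1} ∉ ℤ + τℤ. Then ∑_{k=1}^n θ₃′(w_k − w_{k−1} + μ;τ)/θ₃(w_k − w_{k−1} + μ;τ) − (π/(2i))·∑_{k=1}^n g_μ(w_{n+1} − w_{k−1})·g_μ(w_k − w_{n+1})/g_μ(w_k − w_{k−1}) = n·θ₃′(μ;τ)/θ₃(μ;τ). -/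

import Mathlib

open Complex

noncomputable section

/-- Jacobi theta function `θ₁(w;τ)` with nome `q = exp(iπτ)`. -/
def theta1 (τ w : ℂ) : ℂ :=
  -Complex.I * ∑' n : ℤ, (-1 : ℂ) ^ n *
    Complex.exp (Real.pi * Complex.I * τ * ((n : ℂ) + 1 / 2) ^ 2) *
    Complex.exp ((2 * (n : ℂ) + 1) * Real.pi * Complex.I * w)

/-- Jacobi theta function `θ₃(w;τ)` with nome `q = exp(iπτ)`. -/
def theta3 (τ w : ℂ) : ℂ :=
  ∑' n : ℤ, Complex.exp (Real.pi * Complex.I * τ * (n : ℂ) ^ 2) *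
    Complex.exp (2 * Real.pi * Complex.I * (n : ℂ) * w)

/-- The modulus `τ = 2πi/ℓ`. -/
def tau (ℓ : ℝ) : ℂ := 2 * Real.pi * Complex.I / (ℓ : ℂ)

/-- The function `g_μ(w) = (2/(πi))·θ₁′(0;τ)·θ₃(w+μ;τ)/(θ₃(μ;τ)·θ₁(w;τ))` with `τ = 2πi/ℓ`. -/
def gmu (ℓ μ : ℝ) (w : ℂ) : ℂ :=
  2 / (Real.pi * Complex.I) * deriv (theta1 (tau ℓ)) 0 * theta3 (tau ℓ) (w + (μ : ℂ)) /
    (theta3 (tau ℓ) (μ : ℂ) * theta1 (tau ℓ) w)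

/-- The function `f_μ(z) = ℓ⁻¹ g_μ(z/ℓ)`. -/
def fmu (ℓ μ : ℝ) (z : ℂ) : ℂ := (ℓ : ℂ)⁻¹ * gmu ℓ μ (z / (ℓ : ℂ))

/-- The lattice `{m ω₁ + n ω₂ : m, n ∈ ℤ}`. -/
def lat (ω₁ ω₂ : ℂ) : Set ℂ := {z : ℂ | ∃ m n : ℤ, z = (m : ℂ) * ω₁ + (n : ℂ) * ω₂}

/-- The Weierstrass `℘`-function for the lattice spanned by `ω₁, ω₂`:
`℘(z) = z⁻² + ∑_{ω ∈ Λ∖{0}} ((z−ω)⁻² − ω⁻²)`. -/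
def wp (ω₁ ω₂ : ℂ) (z : ℂ) : ℂ :=
  1 / z ^ 2 + ∑' p : {p : ℤ × ℤ // p ≠ 0},
    (1 / (z - ((p.1.1 : ℂ) * ω₁ + (p.1.2 : ℂ) * ω₂)) ^ 2
      - 1 / ((p.1.1 : ℂ) * ω₁ + (p.1.2 : ℂ) * ω₂) ^ 2)

/-- The point `z_μ = (1/2 − μ)ℓ + πi`. -/
def zmu (ℓ μ : ℝ) : ℂ := (1 / 2 - (μ : ℂ)) * (ℓ : ℂ) + Real.pi * Complex.I

open scoped Classical in
/-- The cycle sum `∑_{σ ∈ Cₙ} ∏_{k=1}^n f(z_{σ(k)} − z_k)`, where `Cₙ` is the set of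
permutations of `{1,…,n}` consisting of a single `n`-cycle. -/
def cycleSum (n : ℕ) (f : ℂ → ℂ) (z : Fin n → ℂ) : ℂ :=
  ∑ σ ∈ Finset.univ.filter
      (fun σ : Equiv.Perm (Fin n) => σ.IsCycle ∧ σ.support = Finset.univ),
    ∏ k : Fin n, f (z (σ k) - z k)

/-- The open horizontal strip `S = {0 < Im z < π}`. -/
def strip : Set ℂ := {z : ℂ | 0 < z.im ∧ z.im < Real.pi}

/-- The top substrip `S_ε = {π − ε < Im z < π}`. -/
def topStrip (ε : ℝ) : Set ℂ := {z : ℂ | Real.pi - ε < z.im ∧ z.im < Real.pi}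

end

/-- Reciprocal of the finite `Q`-Pochhammer symbol, extended by zero to negative indices. -/
noncomputable def poch (Q : ℂ) (n : ℕ) : ℂ := ∏ i ∈ Finset.range n, (1 - Q ^ (i + 1))

noncomputable def rpoch (Q : ℂ) (n : ℤ) : ℂ := if n < 0 then 0 else (poch Q n.toNat)⁻¹

lemma one_sub_pow_ne (Q : ℂ) (hQ : ‖Q‖ < 1) (i : ℕ) : 1 - Q ^ (i + 1) ≠ 0 := by
  intro h
  have h' : Q ^ (i + 1) = 1 := (sub_eq_zero.mp h).symm
  have h2 : ‖Q‖ ^ (i + 1) < 1 := pow_lt_one₀ (norm_nonneg _) hQ (by omega)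
  rw [← norm_pow, h', norm_one] at h2
  exact lt_irrefl _ h2

lemma poch_ne (Q : ℂ) (hQ : ‖Q‖ < 1) (n : ℕ) : poch Q n ≠ 0 :=
  Finset.prod_ne_zero_iff.mpr fun i _ => one_sub_pow_ne Q hQ i

lemma rpoch_rec (Q : ℂ) (hQ : ‖Q‖ < 1) (n : ℤ) :
    rpoch Q (n - 1) = (1 - Q ^ n) * rpoch Q n := by
  rcases lt_trichotomy n 0 with h | h | h
  · simp [rpoch, h, show n - 1 < 0 by omega]
  · subst h; simp [rpoch]
  · obtain ⟨m, rfl⟩ : ∃ m : ℕ, n = m + 1 := ⟨(n - 1).toNat, by omega⟩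
    have e1 : ((m : ℤ) + 1).toNat = m + 1 := by omega
    have e2 : ¬ ((m : ℤ) + 1 < 0) := by omega
    have e3 : ¬ ((m : ℤ) < 0) := by omega
    have h1 := one_sub_pow_ne Q hQ m
    have h2 := poch_ne Q hQ m
    have h3 : poch Q (m + 1) = poch Q m * (1 - Q ^ (m + 1)) := by
      simp [poch, Finset.prod_range_succ]
    have e4 : Q ^ ((m : ℤ) + 1) = Q ^ (m + 1) := by
      exact_mod_cast zpow_natCast Q (m + 1)
    simp only [rpoch, add_sub_cancel_right, e2, e3, if_false, e1, Int.toNat_natCast, h3, e4]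
    field_simp

/-- Coefficients of the finite Jacobi triple product. -/
noncomputable def jcoef (q : ℂ) (N : ℕ) (k : ℤ) : ℂ :=
  poch (q ^ 2) (2 * N) * q ^ (k ^ 2) * rpoch (q ^ 2) (N + k) * rpoch (q ^ 2) (N - k)

lemma jcoef_rec (q : ℂ) (hq0 : q ≠ 0) (hq : ‖q ^ 2‖ < 1) (N : ℕ) (k : ℤ) :
    jcoef q (N + 1) k = (1 + q ^ (4 * N + 2)) * jcoef q N k
      + q ^ (2 * N + 1) * (jcoef q N (k - 1) + jcoef q N (k + 1)) := by
  have hQ0 : q ^ 2 ≠ 0 := pow_ne_zero _ hq0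
  have p : poch (q ^ 2) (2 * (N + 1)) = poch (q ^ 2) (2 * N) *
      (1 - q ^ 2 * ((q ^ 2) ^ (N : ℤ)) ^ 2) * (1 - (q ^ 2) ^ 2 * ((q ^ 2) ^ (N : ℤ)) ^ 2) := by
    rw [show 2 * (N + 1) = 2 * N + 1 + 1 by ring, poch, Finset.prod_range_succ,
      Finset.prod_range_succ, ← poch, zpow_natCast]
    ring
  have a1 := rpoch_rec (q ^ 2) hq (N + 1 + k)
  have a2 := rpoch_rec (q ^ 2) hq (N + k)
  have b1 := rpoch_rec (q ^ 2) hq (N + 1 - k)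
  have b2 := rpoch_rec (q ^ 2) hq (N - k)
  rw [show (N : ℤ) + 1 + k - 1 = N + k by ring] at a1
  rw [show (N : ℤ) + 1 - k - 1 = N - k by ring] at b1
  rw [a1] at a2
  rw [b1] at b2
  have c1 : q ^ ((k - 1) ^ 2) = q ^ (k ^ 2) * ((q ^ 2) ^ k)⁻¹ * q := by
    rw [show (k - 1) ^ 2 = k ^ 2 + (-(2 * k) + 1) by ring, zpow_add₀ hq0, zpow_add₀ hq0,
      zpow_neg, zpow_mul, zpow_one]
    norm_cast
    ring
  have c2 : q ^ ((k + 1) ^ 2) = q ^ (k ^ 2) * ((q ^ 2) ^ k) * q := by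
    rw [show (k + 1) ^ 2 = k ^ 2 + ((2 * k) + 1) by ring, zpow_add₀ hq0, zpow_add₀ hq0,
      zpow_mul, zpow_one]
    norm_cast
    ring
  have d1 : q ^ (4 * N + 2) = q ^ 2 * ((q ^ 2) ^ (N : ℤ)) ^ 2 := by
    rw [zpow_natCast]; ring
  have d2 : q ^ (2 * N + 1) = q * (q ^ 2) ^ (N : ℤ) := by
    rw [zpow_natCast]; ring
  simp only [jcoef]
  rw [show (N : ℤ) + (k - 1) = N + k - 1 by ring, show (N : ℤ) + (k + 1) = N + 1 + k by ring,
    show (N : ℤ) - (k - 1) = N + 1 - k by ring, show (N : ℤ) - (k + 1) = N - k - 1 by ring]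
  push_cast
  rw [a2, b2, a1, b1, c1, c2, d1, d2, p]
  rw [zpow_sub₀ hQ0, zpow_sub₀ hQ0, zpow_add₀ hQ0, zpow_add₀ hQ0, zpow_add₀ hQ0, zpow_one]
  have hv : (q ^ 2) ^ k ≠ 0 := zpow_ne_zero _ hQ0
  generalize (q ^ 2) ^ k = v at *
  generalize (q ^ 2) ^ (N : ℤ) = u at *
  field_simp
  ring

lemma finite_triple (q : ℂ) (hq0 : q ≠ 0) (hq : ‖q ^ 2‖ < 1) (x : ℂ) (hx : x ≠ 0) (N : ℕ) :
    HasSum (fun k : ℤ => jcoef q N k * x ^ k)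
      ((∏ m ∈ Finset.range N, (1 + q ^ (2 * m + 1) * x)) *
        ∏ m ∈ Finset.range N, (1 + q ^ (2 * m + 1) * x⁻¹)) := by
  induction N with
  | zero =>
    simp only [Finset.range_zero, Finset.prod_empty, mul_one]
    have : (1 : ℂ) = jcoef q 0 0 * x ^ (0 : ℤ) := by simp [jcoef, rpoch, poch]
    rw [this]
    apply hasSum_single
    intro k hk
    rcases lt_or_gt_of_ne hk with h | h
    · simp [jcoef, rpoch, h]
    · simp [jcoef, rpoch, h]
  | succ N ih =>
    rw [Finset.prod_range_succ, Finset.prod_range_succ]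
    set P := (∏ m ∈ Finset.range N, (1 + q ^ (2 * m + 1) * x))
    set R := (∏ m ∈ Finset.range N, (1 + q ^ (2 * m + 1) * x⁻¹))
    have s1 := ((Equiv.subRight (1 : ℤ)).hasSum_iff).mpr ih
    have s2 := ((Equiv.addRight (1 : ℤ)).hasSum_iff).mpr ih
    have := (ih.mul_left (1 + q ^ (4 * N + 2))).add
      ((s1.mul_left (q ^ (2 * N + 1) * x)).add (s2.mul_left (q ^ (2 * N + 1) * x⁻¹)))
    have e1 : (fun k : ℤ => jcoef q (N + 1) k * x ^ k) = fun k =>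
        (1 + q ^ (4 * N + 2)) * (jcoef q N k * x ^ k) +
        (q ^ (2 * N + 1) * x * ((fun k => jcoef q N k * x ^ k) ∘ ⇑(Equiv.subRight (1 : ℤ))) k +
          q ^ (2 * N + 1) * x⁻¹ *
            ((fun k => jcoef q N k * x ^ k) ∘ ⇑(Equiv.addRight (1 : ℤ))) k) := by
      ext k
      simp only [Function.comp, Equiv.subRight_apply, Equiv.coe_addRight]
      rw [jcoef_rec q hq0 hq, zpow_sub₀ hx, zpow_add₀ hx, zpow_one]
      field_simp
    have e2 : P * (1 + q ^ (2 * N + 1) * x) * (R * (1 + q ^ (2 * N + 1) * x⁻¹)) =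
        (1 + q ^ (4 * N + 2)) * (P * R) + (q ^ (2 * N + 1) * x * (P * R) +
          q ^ (2 * N + 1) * x⁻¹ * (P * R)) := by
      have : x * x⁻¹ = 1 := mul_inv_cancel₀ hx
      linear_combination (q ^ (4 * N + 2) * (P * R)) * this
    rw [e1, e2]
    exact this

lemma summable_qpow (q : ℂ) (hq : ‖q‖ < 1) (x : ℂ) :
    Summable (fun m : ℕ => ‖q ^ (2 * m + 1) * x‖) := by
  have h : ‖q‖ ^ 2 < 1 := pow_lt_one₀ (norm_nonneg _) hq two_ne_zero
  refine ((summable_geometric_of_lt_one (by positivity) h).mul_left (‖q‖ * ‖x‖)).congr ?_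
  intro m
  rw [norm_mul, norm_pow]
  ring

lemma tendsto_qprod (q : ℂ) (hq : ‖q‖ < 1) (x : ℂ) :
    Filter.Tendsto (fun N => ∏ m ∈ Finset.range N, (1 + q ^ (2 * m + 1) * x)) Filter.atTop
      (nhds (∏' m : ℕ, (1 + q ^ (2 * m + 1) * x))) :=
  (multipliable_one_add_of_summable (summable_qpow q hq x)).hasProd.tendsto_prod_nat

lemma tendsto_poch (Q : ℂ) (hQ : ‖Q‖ < 1) : ∃ φ : ℂ, φ ≠ 0 ∧
    Filter.Tendsto (poch Q) Filter.atTop (nhds φ) := by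
  have hs : Summable (fun i : ℕ => ‖-Q ^ (i + 1)‖) := by
    refine ((summable_geometric_of_lt_one (norm_nonneg _) hQ).mul_left (‖Q‖)).congr ?_
    intro m
    rw [norm_neg, norm_pow]
    ring
  refine ⟨∏' i : ℕ, (1 + -Q ^ (i + 1)), tprod_one_add_ne_zero_of_summable ?_ hs, ?_⟩
  · intro i
    rw [← sub_eq_add_neg]
    exact one_sub_pow_ne Q hQ i
  · have := (multipliable_one_add_of_summable hs).hasProd.tendsto_prod_nat
    refine this.congr fun n => ?_
    simp only [poch, sub_eq_add_neg]

lemma triple (q : ℂ) (hq0 : q ≠ 0) (hq1 : ‖q‖ < 1) (x : ℂ) (hx : x ≠ 0)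
    (hs : Summable (fun k : ℤ => ‖q ^ (k ^ 2) * x ^ k‖))
    (h1 : ∀ m : ℕ, 1 + q ^ (2 * m + 1) * x ≠ 0)
    (h2 : ∀ m : ℕ, 1 + q ^ (2 * m + 1) * x⁻¹ ≠ 0) :
    ∑' k : ℤ, q ^ (k ^ 2) * x ^ k ≠ 0 := by
  have hq : ‖q ^ 2‖ < 1 := by
    rw [norm_pow]; exact pow_lt_one₀ (norm_nonneg _) hq1 two_ne_zero
  obtain ⟨φ, hφ, hT⟩ := tendsto_poch (q ^ 2) hq
  have hTi : Filter.Tendsto (fun n => (poch (q ^ 2) n)⁻¹) Filter.atTop (nhds φ⁻¹) := hT.inv₀ hφ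
  obtain ⟨C, hC⟩ := (Metric.isBounded_range_of_tendsto _ hT).exists_norm_le
  obtain ⟨D, hD⟩ := (Metric.isBounded_range_of_tendsto _ hTi).exists_norm_le
  have hC' : ∀ n, ‖poch (q ^ 2) n‖ ≤ C := fun n => hC _ ⟨n, rfl⟩
  have hD0 : 0 ≤ D := (norm_nonneg _).trans (hD _ ⟨0, rfl⟩)
  have hC0 : 0 ≤ C := (norm_nonneg _).trans (hC' 0)
  have hD' : ∀ n, ‖rpoch (q ^ 2) n‖ ≤ D := by
    intro n
    unfold rpoch
    split_ifs
    · simpa using hD0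
    · exact hD _ ⟨_, rfl⟩
  have lim1 : Filter.Tendsto (fun N : ℕ => ∑' k : ℤ, jcoef q N k * x ^ k) Filter.atTop
      (nhds (∑' k : ℤ, φ * φ⁻¹ * φ⁻¹ * (q ^ (k ^ 2) * x ^ k))) := by
    refine tendsto_tsum_of_dominated_convergence (bound := fun k => C * D * D * ‖q ^ (k ^ 2) * x ^ k‖)
      (hs.mul_left _) ?_ ?_
    · intro k
      have t1 : Filter.Tendsto (fun N : ℕ => poch (q ^ 2) (2 * N)) Filter.atTop (nhds φ) :=
        hT.comp (Filter.tendsto_atTop_mono (fun N => by simp only [id]; omega) Filter.tendsto_id)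
      have t2 : ∀ j : ℤ, Filter.Tendsto (fun N : ℕ => rpoch (q ^ 2) (N + j)) Filter.atTop
          (nhds φ⁻¹) := by
        intro j
        have : Filter.Tendsto (fun N : ℕ => ((N : ℤ) + j).toNat) Filter.atTop Filter.atTop := by
          refine Filter.tendsto_atTop.mpr fun b => ?_
          filter_upwards [Filter.eventually_ge_atTop (b + j.natAbs)] with N hN
          omega
        refine (hTi.comp this).congr' ?_
        filter_upwards [Filter.eventually_ge_atTop j.natAbs] with N hN
        simp [rpoch, show ¬ ((N : ℤ) + j < 0) by omega]
      have := ((t1.mul (t2 k)).mul (t2 (-k))).mul_const (q ^ (k ^ 2) * x ^ k)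
      refine this.congr fun N => ?_
      simp only [jcoef, ← sub_eq_add_neg]
      ring
    · refine Filter.Eventually.of_forall fun N k => ?_
      have : jcoef q N k * x ^ k = poch (q ^ 2) (2 * N) * rpoch (q ^ 2) (N + k) *
        rpoch (q ^ 2) (N - k) * (q ^ (k ^ 2) * x ^ k) := by simp only [jcoef]; ring
      rw [this, norm_mul, norm_mul, norm_mul]
      gcongr
      · exact hC' _
      · exact hD' _
      · exact hD' _
  have lim2 := (tendsto_qprod q hq1 x).mul (tendsto_qprod q hq1 x⁻¹)
  have e := tendsto_nhds_unique lim1 (lim2.congr fun N => (finite_triple q hq0 hq x hx N).tsum_eq.symm)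
  rw [tsum_mul_left] at e
  intro h0
  rw [h0, mul_zero] at e
  exact mul_ne_zero (tprod_one_add_ne_zero_of_summable h1 (summable_qpow q hq1 x))
    (tprod_one_add_ne_zero_of_summable h2 (summable_qpow q hq1 x⁻¹)) e.symm

noncomputable def t1term (τ w : ℂ) (n : ℤ) : ℂ := (-1 : ℂ) ^ n *
    Complex.exp (Real.pi * Complex.I * τ * ((n : ℂ) + 1 / 2) ^ 2) *
    Complex.exp ((2 * (n : ℂ) + 1) * Real.pi * Complex.I * w)

lemma neg_one_zpow_exp (n : ℤ) : (-1 : ℂ) ^ n = Complex.exp (n * (Real.pi * Complex.I)) := by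
  rw [Complex.exp_int_mul, Complex.exp_pi_mul_I]

lemma t1term_eq (τ w : ℂ) (n : ℤ) : t1term τ w n =
    Complex.exp (Real.pi * Complex.I * (τ / 4 + w)) *
      jacobiTheta₂_term n (w + (1 + τ) / 2) τ := by
  rw [t1term, neg_one_zpow_exp, jacobiTheta₂_term, ← Complex.exp_add, ← Complex.exp_add,
    ← Complex.exp_add]
  congr 1
  ring

lemma theta1_eq (τ w : ℂ) : theta1 τ w =
    -Complex.I * (Complex.exp (Real.pi * Complex.I * (τ / 4 + w)) *
      jacobiTheta₂ (w + (1 + τ) / 2) τ) := by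
  rw [jacobiTheta₂, ← tsum_mul_left, theta1]
  congr 1
  exact tsum_congr fun n => t1term_eq τ w n

lemma theta3_eq (τ w : ℂ) : theta3 τ w = jacobiTheta₂ w τ := by
  refine tsum_congr fun n => ?_
  rw [jacobiTheta₂_term, ← Complex.exp_add]
  congr 1
  ring

lemma hasSum_t1 (τ w : ℂ) (hτ : 0 < τ.im) : HasSum (t1term τ w) (Complex.I * theta1 τ w) := by
  have := (hasSum_jacobiTheta₂_term (w + (1 + τ) / 2) hτ).mul_left
    (Complex.exp (Real.pi * Complex.I * (τ / 4 + w)))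
  have e : Complex.I * theta1 τ w = Complex.exp (Real.pi * Complex.I * (τ / 4 + w)) *
      jacobiTheta₂ (w + (1 + τ) / 2) τ := by
    rw [theta1_eq, ← mul_assoc, mul_neg, Complex.I_mul_I, neg_neg, one_mul]
  rw [e]
  exact this.congr_fun fun n => t1term_eq τ w n

lemma theta1_differentiable (τ : ℂ) (hτ : 0 < τ.im) : Differentiable ℂ (theta1 τ) := by
  intro w
  have : theta1 τ = fun w => -Complex.I * (Complex.exp (Real.pi * Complex.I * (τ / 4 + w)) *
      jacobiTheta₂ (w + (1 + τ) / 2) τ) := funext fun w => theta1_eq τ w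
  rw [this]
  have h := differentiableAt_jacobiTheta₂_fst (w + (1 + τ) / 2) hτ
  have h2 : DifferentiableAt ℂ (fun w => jacobiTheta₂ (w + (1 + τ) / 2) τ) w :=
    DifferentiableAt.comp w (g := fun z => jacobiTheta₂ z τ) h (by fun_prop)
  fun_prop

lemma theta3_differentiable (τ : ℂ) (hτ : 0 < τ.im) : Differentiable ℂ (theta3 τ) := by
  intro w
  have : theta3 τ = fun w => jacobiTheta₂ w τ := funext fun w => theta3_eq τ w
  rw [this]
  exact differentiableAt_jacobiTheta₂_fst w hτ

lemma theta1_shift (τ w : ℂ) : theta1 τ (w + (1 + τ) / 2) =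
    Complex.exp (-(Real.pi * Complex.I * τ / 4)) * Complex.exp (-(Real.pi * Complex.I * w)) *
      theta3 τ w := by
  rw [theta1_eq, theta3_eq, show w + (1 + τ) / 2 + (1 + τ) / 2 = w + τ + 1 by ring,
    jacobiTheta₂_add_left, jacobiTheta₂_add_left']
  have : -Complex.I = Complex.exp (-(Real.pi * Complex.I / 2)) := by
    rw [Complex.exp_neg, show (Real.pi : ℂ) * Complex.I / 2 = Real.pi / 2 * Complex.I by ring,
      Complex.exp_pi_div_two_mul_I, Complex.inv_I]
  rw [this, ← mul_assoc, ← mul_assoc, ← Complex.exp_add, ← Complex.exp_add, ← Complex.exp_add]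
  congr 2
  ring

lemma theta1_neg (τ w : ℂ) : theta1 τ (-w) = -theta1 τ w := by
  unfold theta1
  rw [← mul_neg, ← tsum_neg, ← (Equiv.subLeft (-1 : ℤ)).tsum_eq]
  congr 1
  refine tsum_congr fun n => ?_
  have : (-1 : ℂ) ^ (-1 - n) = - (-1 : ℂ) ^ n := by
    rcases Int.even_or_odd n with h | h
    · rw [h.neg_one_zpow, Odd.neg_one_zpow (by grind)]
    · rw [h.neg_one_zpow, Even.neg_one_zpow (by grind), neg_neg]
  simp only [Equiv.subLeft_apply, this]
  push_cast
  rw [neg_mul, neg_mul]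
  congr 2
  · congr 2; ring
  · congr 1; ring

/-- Every product of two values of `theta1` is a 2x2 determinant. -/
lemma theta1_mul (τ : ℂ) (hτ : 0 < τ.im) : ∃ A B : ℂ → ℂ, ∀ x y,
    theta1 τ (x + y) * theta1 τ (x - y) = A x * B y - B x * A y := by
  have hτ2 : 0 < (2 * τ).im := by simpa using hτ
  let et : ℂ → ℤ → ℂ := fun x p => jacobiTheta₂_term p (2 * x) (2 * τ)
  let ot : ℂ → ℤ → ℂ := fun x p => Complex.exp (Real.pi * Complex.I * (τ / 2 + 2 * x)) *
    jacobiTheta₂_term p (2 * x + τ) (2 * τ)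
  have hE : ∀ x, Summable (et x) := fun x => (summable_jacobiTheta₂_term_iff _ _).mpr hτ2
  have hO : ∀ x, Summable (ot x) :=
    fun x => ((summable_jacobiTheta₂_term_iff _ _).mpr hτ2).mul_left _
  refine ⟨fun x => ∑' p, et x p, fun x => ∑' p, ot x p, fun x y => ?_⟩
  have hS1 := hasSum_t1 τ (x + y) hτ
  have hS2 := hasSum_t1 τ (x - y) hτ
  have hS := hS1.mul hS2 (summable_mul_of_summable_norm hS1.summable.norm hS2.summable.norm)
  have hEO := (hE x).hasSum.mul (hO y).hasSum
    (summable_mul_of_summable_norm (hE x).norm (hO y).norm)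
  have hOE := (hO x).hasSum.mul (hE y).hasSum
    (summable_mul_of_summable_norm (hO x).norm (hE y).norm)
  let φ : (ℤ × ℤ) ⊕ (ℤ × ℤ) → ℤ × ℤ :=
    Sum.elim (fun z => (z.1 + z.2, z.1 - z.2 - 1)) (fun z => (z.1 + z.2, z.1 - z.2))
  have hφ : Function.Bijective φ := by
    constructor
    · rintro (⟨a, b⟩ | ⟨a, b⟩) (⟨c, d⟩ | ⟨c, d⟩) h <;>
        simp only [φ, Sum.elim_inl, Sum.elim_inr, Prod.mk.injEq] at h
      · obtain rfl : a = c := by omega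
        obtain rfl : b = d := by omega
        rfl
      · omega
      · omega
      · obtain rfl : a = c := by omega
        obtain rfl : b = d := by omega
        rfl
    · rintro ⟨m, n⟩
      rcases Int.even_or_odd (m + n) with h | h
      · obtain ⟨k, hk⟩ := h
        refine ⟨Sum.inr (k, m - k), ?_⟩
        simp only [φ, Sum.elim_inr, Prod.mk.injEq]
        omega
      · obtain ⟨k, hk⟩ := h
        refine ⟨Sum.inl (k + 1, m - k - 1), ?_⟩
        simp only [φ, Sum.elim_inl, Prod.mk.injEq]
        omega
  let e := Equiv.ofBijective φ hφ
  have hS' := e.hasSum_iff.mpr hS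
  have hR : HasSum ((fun z : ℤ × ℤ => t1term τ (x + y) z.1 * t1term τ (x - y) z.2) ∘ ⇑e)
      (-((∑' p, et x p) * ∑' p, ot y p) + (∑' p, ot x p) * ∑' p, et y p) := by
    refine HasSum.sum (hEO.neg.congr_fun ?_) (hOE.congr_fun ?_)
    · rintro ⟨p, r⟩
      simp only [Function.comp, e, φ, Equiv.ofBijective_apply, Sum.elim_inl, t1term, et, ot,
        jacobiTheta₂_term, neg_one_zpow_exp]
      have : (-1 : ℂ) = Complex.exp ((1 - 2 * p : ℤ) * (Real.pi * Complex.I)) := by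
        rw [← neg_one_zpow_exp, zpow_sub₀ (by norm_num), zpow_mul]; simp
      rw [← neg_one_mul, this]
      simp only [← Complex.exp_add]
      rw [Complex.exp_eq_exp_iff_exists_int]
      refine ⟨2 * p - 1, ?_⟩
      push_cast
      ring
    · rintro ⟨p, r⟩
      simp only [Function.comp, e, φ, Equiv.ofBijective_apply, Sum.elim_inr, t1term, et, ot,
        jacobiTheta₂_term, neg_one_zpow_exp]
      simp only [← Complex.exp_add]
      rw [Complex.exp_eq_exp_iff_exists_int]
      refine ⟨p, ?_⟩
      push_cast
      ring
  have := hS'.unique hR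
  linear_combination -this + theta1 τ (x + y) * theta1 τ (x - y) * Complex.I_mul_I

lemma fay (τ : ℂ) (hτ : 0 < τ.im) (a b c : ℂ) :
    deriv (theta1 τ) 0 * theta1 τ (a + b) * theta1 τ (b + c) * theta1 τ (a + c) =
      (deriv (theta1 τ) a * theta1 τ b + theta1 τ a * deriv (theta1 τ) b) *
        (theta1 τ c * theta1 τ (a + b + c)) +
      theta1 τ a * theta1 τ b * (deriv (theta1 τ) c * theta1 τ (a + b + c) -
        theta1 τ c * deriv (theta1 τ) (a + b + c)) := by
  obtain ⟨A, B, hAB⟩ := theta1_mul τ hτ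
  have odd := theta1_neg τ
  have dif := theta1_differentiable τ hτ
  have hd : ∀ z, HasDerivAt (theta1 τ) (deriv (theta1 τ) z) z := fun z => (dif z).hasDerivAt
  have f0 : theta1 τ 0 = 0 := by
    have := odd 0
    rw [neg_zero] at this
    linear_combination this / 2
  have deven : deriv (theta1 τ) (-b) = deriv (theta1 τ) b := by
    have h1 := ((hd (-b)).scomp b (hasDerivAt_neg b))
    have h2 : (theta1 τ ∘ Neg.neg) = fun w => -theta1 τ w := funext odd
    rw [h2] at h1
    have := h1.unique (hd b).neg
    simpa using this
  generalize theta1 τ = f at *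
  have key : ∀ x y v u, f (x + y) * f (x - y) * (f (u + v) * f (u - v))
      - f (x + u) * f (x - u) * (f (y + v) * f (y - v))
      + f (x + v) * f (x - v) * (f (y + u) * f (y - u)) = 0 := by
    intro x y v u
    simp only [hAB]
    ring
  set x := (a - b) / 2 with hx
  set v := (a + b) / 2 with hv
  set y := c + v with hy
  have D : HasDerivAt (fun u => f (x + y) * f (x - y) * (f (u + v) * f (u - v))
      - f (x + u) * f (x - u) * (f (y + v) * f (y - v))
      + f (x + v) * f (x - v) * (f (y + u) * f (y - u)))
      (f (x + y) * f (x - y) * (deriv f (v + v) * f (v - v) + f (v + v) * deriv f (v - v))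
       - (deriv f (x + v) * f (x - v) + f (x + v) * (-deriv f (x - v))) * (f (y + v) * f (y - v))
       + f (x + v) * f (x - v) * (deriv f (y + v) * f (y - v) + f (y + v) * (-deriv f (y - v)))) v
      := by
    have k1 : ∀ z, HasDerivAt (fun u => f (z + u)) (deriv f (z + v)) v := fun z =>
      (hd (z + v)).comp_const_add z v
    have k2 : ∀ z, HasDerivAt (fun u => f (z - u)) (-deriv f (z - v)) v := fun z =>
      (hd (z - v)).comp_const_sub z v
    have k3 : HasDerivAt (fun u => f (u + v)) (deriv f (v + v)) v := (hd (v + v)).comp_add_const v v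
    have k4 : HasDerivAt (fun u => f (u - v)) (deriv f (v - v)) v := (hd (v - v)).comp_sub_const v v
    exact (((k3.mul k4).const_mul _).sub (((k1 x).mul (k2 x)).mul_const _)).add
      (((k1 y).mul (k2 y)).const_mul _)
  have D0 := D.unique ((hasDerivAt_const v (0 : ℂ)).congr_of_eventuallyEq
    (Filter.Eventually.of_forall (key x y v)))
  have e1 : x + y = a + c := by simp only [hx, hy, hv]; ring
  have e2 : x - y = -(b + c) := by simp only [hx, hy, hv]; ring
  have e3 : v + v = a + b := by simp only [hv]; ring
  have e4 : v - v = 0 := by ring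
  have e5 : x + v = a := by simp only [hx, hv]; ring
  have e6 : x - v = -b := by simp only [hx, hv]; ring
  have e7 : y + v = a + b + c := by simp only [hy, hv]; ring
  have e8 : y - v = c := by simp only [hy]; ring
  rw [e1, e2, e3, e4, e5, e6, e7, e8, odd, odd, deven, f0] at D0
  linear_combination -D0

lemma theta3_ne (τ : ℂ) (hτ : 0 < τ.im) (z : ℂ) (hz : z - (1 + τ) / 2 ∉ lat 1 τ) :
    jacobiTheta₂ z τ ≠ 0 := by
  set q := Complex.exp (Real.pi * Complex.I * τ) with hq
  set x := Complex.exp (2 * Real.pi * Complex.I * z) with hx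
  have hterm : ∀ k : ℤ, jacobiTheta₂_term k z τ = q ^ (k ^ 2) * x ^ k := by
    intro k
    rw [hq, hx, ← Complex.exp_int_mul, ← Complex.exp_int_mul, ← Complex.exp_add,
      jacobiTheta₂_term]
    congr 1
    push_cast
    ring
  have hs := ((summable_jacobiTheta₂_term_iff z τ).mpr hτ).norm
  rw [jacobiTheta₂]
  simp only [hterm] at hs ⊢
  have hq1 : ‖q‖ < 1 := by
    rw [hq, Complex.norm_exp, Real.exp_lt_one_iff]
    have : (Real.pi * Complex.I * τ).re = -(Real.pi * τ.im) := by simp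
    rw [this]
    have := mul_pos Real.pi_pos hτ
    linarith
  have aux : ∀ (m : ℕ) (y : ℂ), 1 + q ^ (2 * m + 1) * Complex.exp (2 * Real.pi * Complex.I * y) = 0
      → ∃ k : ℤ, (2 * m + 1) * τ + 2 * y - 1 = 2 * k := by
    intro m y h
    have h1 : Complex.exp (Real.pi * Complex.I * ((2 * m + 1) * τ + 2 * y - 1)) = 1 := by
      rw [hq, ← Complex.exp_nat_mul, ← Complex.exp_add] at h
      rw [show Real.pi * Complex.I * ((2 * m + 1) * τ + 2 * y - 1) =
        (((2 * m + 1 : ℕ) : ℂ) * (Real.pi * Complex.I * τ) + 2 * Real.pi * Complex.I * y)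
          - Real.pi * Complex.I by push_cast; ring, Complex.exp_sub, Complex.exp_pi_mul_I]
      linear_combination -h
    obtain ⟨k, hk⟩ := Complex.exp_eq_one_iff.mp h1
    refine ⟨k, ?_⟩
    have : (Real.pi : ℂ) * Complex.I ≠ 0 :=
      mul_ne_zero (Complex.ofReal_ne_zero.mpr Real.pi_ne_zero) Complex.I_ne_zero
    apply mul_left_cancel₀ this
    linear_combination hk
  refine triple q (Complex.exp_ne_zero _) hq1 x (Complex.exp_ne_zero _) hs ?_ ?_
  · intro m h
    obtain ⟨k, hk⟩ := aux m z h
    refine hz ⟨k, -(m + 1), ?_⟩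
    push_cast
    linear_combination hk / 2
  · intro m h
    rw [hx, ← Complex.exp_neg, ← mul_neg] at h
    obtain ⟨k, hk⟩ := aux m (-z) h
    refine hz ⟨-k - 1, m, ?_⟩
    push_cast
    linear_combination -hk / 2

lemma theta1_ne (τ : ℂ) (hτ : 0 < τ.im) (z : ℂ) (hz : z ∉ lat 1 τ) : theta1 τ z ≠ 0 := by
  rw [theta1_eq]
  refine mul_ne_zero (neg_ne_zero.mpr Complex.I_ne_zero) (mul_ne_zero (Complex.exp_ne_zero _)
    (theta3_ne τ hτ _ ?_))
  rwa [add_sub_cancel_right]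

lemma theta1_shift_deriv (τ : ℂ) (hτ : 0 < τ.im) (w : ℂ) :
    deriv (theta1 τ) (w + (1 + τ) / 2) =
    Complex.exp (-(Real.pi * Complex.I * τ / 4)) * Complex.exp (-(Real.pi * Complex.I * w)) *
      (deriv (theta3 τ) w - Real.pi * Complex.I * theta3 τ w) := by
  have h1 : HasDerivAt (fun w => theta1 τ (w + (1 + τ) / 2)) (deriv (theta1 τ) (w + (1 + τ) / 2)) w :=
    (theta1_differentiable τ hτ _).hasDerivAt.comp_add_const _ _
  have h2 : HasDerivAt (fun w => Complex.exp (-(Real.pi * Complex.I * w)))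
      (Complex.exp (-(Real.pi * Complex.I * w)) * (-(Real.pi * Complex.I * 1))) w :=
    (((hasDerivAt_id w).const_mul _).neg).cexp
  have h3 := (h2.const_mul (Complex.exp (-(Real.pi * Complex.I * τ / 4)))).mul
    (theta3_differentiable τ hτ w).hasDerivAt
  rw [funext (theta1_shift τ)] at h1
  rw [h1.unique h3]
  ring

lemma fay3 (τ : ℂ) (hτ : 0 < τ.im) (a b c : ℂ) :
    deriv (theta1 τ) 0 * theta1 τ (a + b) * theta3 τ (b + c) * theta3 τ (a + c) =
      (deriv (theta1 τ) a * theta1 τ b + theta1 τ a * deriv (theta1 τ) b) *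
        (theta3 τ c * theta3 τ (a + b + c)) +
      theta1 τ a * theta1 τ b * (deriv (theta3 τ) c * theta3 τ (a + b + c) -
        theta3 τ c * deriv (theta3 τ) (a + b + c)) := by
  have h := fay τ hτ a b (c + (1 + τ) / 2)
  simp only [← add_assoc, theta1_shift, theta1_shift_deriv τ hτ] at h
  have ea : ∀ u v : ℂ, Complex.exp (-(Real.pi * Complex.I * (u + v))) =
      Complex.exp (-(Real.pi * Complex.I * u)) * Complex.exp (-(Real.pi * Complex.I * v)) := by
    intro u v
    rw [← Complex.exp_add]
    congr 1
    ring
  simp only [ea] at h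
  have h0 := Complex.exp_ne_zero (-(Real.pi * Complex.I * τ / 4))
  have h1 := Complex.exp_ne_zero (-(Real.pi * Complex.I * a))
  have h2 := Complex.exp_ne_zero (-(Real.pi * Complex.I * b))
  have h3 := Complex.exp_ne_zero (-(Real.pi * Complex.I * c))
  generalize Complex.exp (-(Real.pi * Complex.I * τ / 4)) = K at *
  generalize Complex.exp (-(Real.pi * Complex.I * a)) = ka at *
  generalize Complex.exp (-(Real.pi * Complex.I * b)) = kb at *
  generalize Complex.exp (-(Real.pi * Complex.I * c)) = kc at *
  have hne : K ^ 2 * ka * kb * kc ^ 2 ≠ 0 := by positivity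
  apply mul_left_cancel₀ hne
  linear_combination h

lemma gterm (ℓ μ : ℝ) (hτ : 0 < (tau ℓ).im) (hμ : theta3 (tau ℓ) (μ : ℂ) ≠ 0) (a b : ℂ)
    (ha : a ∉ lat 1 (tau ℓ)) (hb : b ∉ lat 1 (tau ℓ)) (hab : a + b ∉ lat 1 (tau ℓ))
    (h3 : theta3 (tau ℓ) (a + b + μ) ≠ 0) :
    (Real.pi : ℂ) / (2 * Complex.I) * (gmu ℓ μ a * gmu ℓ μ b / gmu ℓ μ (a + b)) =
      deriv (theta3 (tau ℓ)) (a + b + μ) / theta3 (tau ℓ) (a + b + μ)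
      - deriv (theta3 (tau ℓ)) μ / theta3 (tau ℓ) μ
      - deriv (theta1 (tau ℓ)) a / theta1 (tau ℓ) a
      - deriv (theta1 (tau ℓ)) b / theta1 (tau ℓ) b := by
  have F := fay3 (tau ℓ) hτ a b μ
  have na := theta1_ne _ hτ a ha
  have nb := theta1_ne _ hτ b hb
  have nab := theta1_ne _ hτ _ hab
  have npi : (Real.pi : ℂ) ≠ 0 := Complex.ofReal_ne_zero.mpr Real.pi_ne_zero
  have nI := Complex.I_ne_zero
  have step : (Real.pi : ℂ) / (2 * Complex.I) * (gmu ℓ μ a * gmu ℓ μ b / gmu ℓ μ (a + b)) =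
      -(deriv (theta1 (tau ℓ)) 0 * theta1 (tau ℓ) (a + b) * theta3 (tau ℓ) (b + μ) *
        theta3 (tau ℓ) (a + μ)) / (theta3 (tau ℓ) μ * theta3 (tau ℓ) (a + b + μ) *
          theta1 (tau ℓ) a * theta1 (tau ℓ) b) := by
    by_cases hd : deriv (theta1 (tau ℓ)) 0 = 0
    · simp [gmu, hd]
    · simp only [gmu]
      generalize deriv (theta1 (tau ℓ)) 0 = d at *
      field_simp
      rw [Complex.I_sq]
      try ring
  rw [step, F]
  field_simp
  ring

/-- eq:x-sum=cst: the key identity in the proof of the recursion for cycle sums. -/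
theorem stmt8 (ℓ μ : ℝ) (hℓ : 0 < ℓ)
    (hμ : theta3 (tau ℓ) (μ : ℂ) ≠ 0)
    (n : ℕ) (hn : 3 ≤ n) (w : ℕ → ℂ) (hw0 : w 0 = w n)
    (h1 : ∀ k ∈ Finset.Icc 1 n, w k - w (k - 1) ∉ lat 1 (tau ℓ))
    (h2 : ∀ k ∈ Finset.Icc 1 n, theta3 (tau ℓ) (w k - w (k - 1) + (μ : ℂ)) ≠ 0)
    (h3 : ∀ k ∈ Finset.Icc 1 n, w (n + 1) - w (k - 1) ∉ lat 1 (tau ℓ))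
    (h4 : ∀ k ∈ Finset.Icc 1 n, w k - w (n + 1) ∉ lat 1 (tau ℓ)) :
    (∑ k ∈ Finset.Icc 1 n,
        deriv (theta3 (tau ℓ)) (w k - w (k - 1) + (μ : ℂ)) /
          theta3 (tau ℓ) (w k - w (k - 1) + (μ : ℂ)))
      - (Real.pi : ℂ) / (2 * Complex.I) *
        ∑ k ∈ Finset.Icc 1 n,
          gmu ℓ μ (w (n + 1) - w (k - 1)) * gmu ℓ μ (w k - w (n + 1)) /
            gmu ℓ μ (w k - w (k - 1))
      = (n : ℂ) * deriv (theta3 (tau ℓ)) (μ : ℂ) / theta3 (tau ℓ) (μ : ℂ) := by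
  have hτ : 0 < (tau ℓ).im := by
    have : tau ℓ = ((2 * Real.pi / ℓ : ℝ) : ℂ) * Complex.I := by
      simp only [tau]; push_cast; ring
    rw [this, Complex.im_ofReal_mul, Complex.I_im, mul_one]
    positivity
  have dneg : ∀ z, deriv (theta1 (tau ℓ)) (-z) = deriv (theta1 (tau ℓ)) z := by
    intro z
    have hd := fun z => ((theta1_differentiable _ hτ) z).hasDerivAt
    have h1 := ((hd (-z)).scomp z (hasDerivAt_neg z))
    have h2 : (theta1 (tau ℓ) ∘ Neg.neg) = fun w => -theta1 (tau ℓ) w := funext (theta1_neg _)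
    rw [h2] at h1
    have := h1.unique (hd z).neg
    simpa using this
  set L : ℕ → ℂ := fun k => deriv (theta1 (tau ℓ)) (w k - w (n + 1)) /
    theta1 (tau ℓ) (w k - w (n + 1)) with hL
  rw [Finset.mul_sum, ← Finset.sum_sub_distrib]
  have : ∀ k ∈ Finset.Icc 1 n, deriv (theta3 (tau ℓ)) (w k - w (k - 1) + (μ : ℂ)) /
      theta3 (tau ℓ) (w k - w (k - 1) + (μ : ℂ)) - (Real.pi : ℂ) / (2 * Complex.I) *
      (gmu ℓ μ (w (n + 1) - w (k - 1)) * gmu ℓ μ (w k - w (n + 1)) / gmu ℓ μ (w k - w (k - 1)))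
      = deriv (theta3 (tau ℓ)) (μ : ℂ) / theta3 (tau ℓ) (μ : ℂ) + (L k - L (k - 1)) := by
    intro k hk
    have e : w k - w (k - 1) = (w (n + 1) - w (k - 1)) + (w k - w (n + 1)) := by ring
    have g := gterm ℓ μ hτ hμ _ _ (h3 k hk) (h4 k hk) (e ▸ h1 k hk) (e ▸ h2 k hk)
    rw [← e] at g
    rw [g, hL]
    have e2 : w (n + 1) - w (k - 1) = -(w (k - 1) - w (n + 1)) := by ring
    rw [e2, dneg, theta1_neg]
    simp only [div_neg]
    ring
  rw [Finset.sum_congr rfl this, Finset.sum_add_distrib, Finset.sum_const, Nat.card_Icc]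
  have tel : ∑ k ∈ Finset.Icc 1 n, (L k - L (k - 1)) = 0 := by
    have tel' : ∀ m : ℕ, ∑ k ∈ Finset.Icc 1 m, (L k - L (k - 1)) = L m - L 0 := by
      intro m
      induction m with
      | zero => simp
      | succ m ih =>
        rw [Finset.sum_Icc_succ_top (by omega), ih, Nat.add_sub_cancel]
        ring
    rw [tel', hL]
    simp only [hw0, sub_self]
  rw [tel, nsmul_eq_mul]
  simp only [Nat.add_sub_cancel]
  ring
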